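/- arXiv:1411.6938 — 11 statements merged into one kernel-verified Lean document; each statement's English description precedes it below -/
import Mathlib

section
/- Let σ0 > 0, α > 0, μ0 ∈ ℝ, K > 0, let γ⁻ be the negative real root of (1/2)σ0²γ² + (μ0 − (1/2)σ0²)γ − α = 0, and set b0 := −γ⁻K/(1−γ⁻). Then for every s > 0 one has (K − b0)(s/b0)^{γ⁻} ≥ max(K − s, 0), and the inequality is strict for every s ≠ b0. -/
open Real

/-- Strict Bernoulli inequality for a negative real exponent. -/
theorem one_add_mul_sub_one_lt_rpow_of_neg {x p : ℝ} (hx : 0 < x) (hx1 : x ≠ 1) (hp : p < 0) :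
    1 + p * (x - 1) < x ^ p := by
  have hinv : 0 < x⁻¹ := inv_pos.mpr hx
  have h := one_add_mul_self_lt_rpow_one_add (s := x⁻¹ - 1) (p := 1 - p) (by linarith)
    (by rw [sub_ne_zero]; simpa using hx1) (by linarith)
  have hpow : x * (1 + (x⁻¹ - 1)) ^ (1 - p) = x ^ p := by
    rw [add_sub_cancel, inv_rpow hx.le, ← rpow_neg hx.le, neg_sub, rpow_sub_one hx.ne']
    field_simp
  calc 1 + p * (x - 1) = x * (1 + (1 - p) * (x⁻¹ - 1)) := by field_simp; ring
    _ < x * (1 + (x⁻¹ - 1)) ^ (1 - p) := by gcongr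
    _ = x ^ p := hpow

/-- Condition (v3) of Theorem 1.5(iii)(a): McKean's candidate value function dominates
the gain function (K − ·)⁺, strictly away from b0. -/
theorem stmt_2 (σ0 α μ0 K γm : ℝ) (hσ0 : 0 < σ0) (hα : 0 < α) (hK : 0 < K)
    (hγm : γm < 0)
    (hroot : (1/2) * σ0^2 * γm^2 + (μ0 - (1/2) * σ0^2) * γm - α = 0)
    (b0 : ℝ) (hb0 : b0 = -γm * K / (1 - γm)) :
    ∀ s : ℝ, 0 < s →
      (K - b0) * (s / b0) ^ γm ≥ max (K - s) 0 ∧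
      (s ≠ b0 → (K - b0) * (s / b0) ^ γm > max (K - s) 0) := by
  intro s hs
  have hden : 0 < 1 - γm := by linarith
  have hb : 0 < b0 := hb0 ▸ div_pos (mul_pos (neg_pos.mpr hγm) hK) hden
  have hmul : b0 * (1 - γm) = -γm * K := by rw [hb0, div_mul_cancel₀ _ hden.ne']
  have hKb : 0 < K - b0 := by
    refine pos_of_mul_pos_left (b := 1 - γm) ?_ hden.le
    linarith
  have hstrict : s ≠ b0 → (K - b0) * (s / b0) ^ γm > max (K - s) 0 := by
    intro hne
    refine max_lt ?_ (mul_pos hKb (rpow_pos_of_pos (div_pos hs hb) _))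
    have hne1 : s / b0 ≠ 1 := by rwa [Ne, div_eq_one_iff_eq hb.ne']
    calc K - s = (K - b0) * (1 + γm * (s / b0 - 1)) := by
          field_simp
          linear_combination (s - b0) * -hmul
      _ < (K - b0) * (s / b0) ^ γm := by
          gcongr
          exact one_add_mul_sub_one_lt_rpow_of_neg (div_pos hs hb) hne1 hγm
  refine ⟨?_, hstrict⟩
  rcases eq_or_ne s b0 with rfl | hne
  · rw [div_self hb.ne', one_rpow, mul_one, max_eq_left hKb.le]
  · exact (hstrict hne).le
end

section
/- Let σ0 > 0, α > 0, μ0 ∈ ℝ, K > 0, let γ⁻ be the negative real root of (1/2)σ0²γ² + (μ0 − (1/2)σ0²)γ − α = 0, and set b0 := −γ⁻K/(1−γ⁻). Suppose s0 satisfies b0 ≤ s0 < K. Then for every s > s0 one has (K − s0)(s/s0)^{γ⁻} > max(K − s, 0). -/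
open Real

/-- Condition (v3) in the proof of Lemma 2.1: if b0 ≤ s0 < K, then
(K − s0)(s/s0)^{γ⁻} strictly dominates the gain function to the right of s0. -/
theorem stmt_3 (σ0 α μ0 K γm s0 : ℝ) (hσ0 : 0 < σ0) (hα : 0 < α) (hK : 0 < K)
    (hγm : γm < 0)
    (hroot : (1/2) * σ0^2 * γm^2 + (μ0 - (1/2) * σ0^2) * γm - α = 0)
    (b0 : ℝ) (hb0 : b0 = -γm * K / (1 - γm))
    (hs0 : b0 ≤ s0) (hs0K : s0 < K) :
    ∀ s : ℝ, s0 < s → (K - s0) * (s / s0) ^ γm > max (K - s) 0 := by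
  intro s hs
  have hg : 0 < 1 - γm := by linarith
  have hb : -γm * K ≤ s0 * (1 - γm) := by
    rw [hb0, div_le_iff₀ hg] at hs0
    exact hs0
  have hs0pos : 0 < s0 := by
    have : 0 < -γm * K := mul_pos (neg_pos.mpr hγm) hK
    exact pos_of_mul_pos_left (this.trans_le hb) hg.le
  have hx : 1 < s / s0 := (one_lt_div hs0pos).mpr hs
  have hx0 : 0 < s / s0 := by linarith
  have hKs : 0 < K - s0 := sub_pos.mpr hs0K
  refine max_lt ?_ (mul_pos hKs (Real.rpow_pos_of_pos hx0 _))
  have hbern := mul_lt_mul_of_pos_left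
    (one_add_mul_sub_one_lt_rpow_of_neg hx0 hx.ne' hγm) hKs
  have hs_eq : s = s0 * (s / s0) := by field_simp
  have hslope : 0 ≤ (s0 * (1 - γm) - -γm * K) * (s / s0 - 1) :=
    mul_nonneg (sub_nonneg.mpr hb) (by linarith)
  refine lt_of_le_of_lt ?_ hbern
  linarith
end

section
/- Let σ0 > 0, α > 0, μ0 ∈ ℝ, K > 0, let γ⁻ be the negative real root of (1/2)σ0²γ² + (μ0 − (1/2)σ0²)γ − α = 0, set b0 := −γ⁻K/(1−γ⁻), and suppose 0 < s0 < b0. Let v ∈ ℝ satisfy K − s0 < v < (K − b0)(s0/b0)^{γ⁻}. Then the equation v·(s/s0)^{γ⁻} = K − s has exactly two solutions s in the interval (s0, K); denoting them s1 < s2, one has s0 < s1 < b0 < s2 < K, and moreover v·(s/s0)^{γ⁻} < K − s for all s with s1 < s < s2. -/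
open Real

theorem strictConvexOn_rpow_of_neg {p : ℝ} (hp : p < 0) :
    StrictConvexOn ℝ (Set.Ioi 0) fun x : ℝ ↦ x ^ p := by
  refine ⟨convex_Ioi 0, fun x hx y hy hxy a b ha hb hab ↦ ?_⟩
  have hx : 0 < x := hx
  have hy : 0 < y := hy
  have hlog := strictConcaveOn_log_Ioi.2 hx hy hxy ha hb hab
  have hexp := convexOn_exp.2 (Set.mem_univ (log x * p)) (Set.mem_univ (log y * p)) ha.le hb.le hab
  simp only [smul_eq_mul] at hlog hexp ⊢
  rw [rpow_def_of_pos (by positivity : 0 < a * x + b * y), rpow_def_of_pos hx, rpow_def_of_pos hy]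
  refine (exp_lt_exp.2 ?_).trans_le hexp
  linarith [mul_lt_mul_of_neg_right hlog hp]

theorem StrictConvexOn.neg_of_eq_zero_of_eq_zero {S : Set ℝ} {f : ℝ → ℝ}
    (hf : StrictConvexOn ℝ S f) {x y z : ℝ} (hx : x ∈ S) (hy : y ∈ S) (hfx : f x = 0)
    (hfy : f y = 0) (hxz : x < z) (hzy : z < y) : f z < 0 := by
  have hz : z ∈ openSegment ℝ x y := by
    rw [openSegment_eq_Ioo (hxz.trans hzy)]
    exact ⟨hxz, hzy⟩
  simpa [hfx, hfy] using hf.lt_on_openSegment hx hy (hxz.trans hzy).ne hz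

/-- Lemma 2.5: the equation v(s/s0)^{γ⁻} = K − s has exactly two solutions in (s0, K),
one below b0 and one above, and the curve lies strictly below the line between them. -/
theorem stmt_5 (σ0 α μ0 K γm s0 v : ℝ) (hσ0 : 0 < σ0) (hα : 0 < α) (hK : 0 < K)
    (hγm : γm < 0)
    (hroot : (1/2) * σ0^2 * γm^2 + (μ0 - (1/2) * σ0^2) * γm - α = 0)
    (b0 : ℝ) (hb0 : b0 = -γm * K / (1 - γm))
    (hs0pos : 0 < s0) (hs0b0 : s0 < b0)
    (hv1 : K - s0 < v) (hv2 : v < (K - b0) * (s0 / b0) ^ γm) :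
    ∃ s1 s2 : ℝ, s0 < s1 ∧ s1 < b0 ∧ b0 < s2 ∧ s2 < K ∧
      v * (s1 / s0) ^ γm = K - s1 ∧
      v * (s2 / s0) ^ γm = K - s2 ∧
      (∀ s : ℝ, s0 < s → s < K → v * (s / s0) ^ γm = K - s → s = s1 ∨ s = s2) ∧
      (∀ s : ℝ, s1 < s → s < s2 → v * (s / s0) ^ γm < K - s) := by
  have hb0K : b0 < K := by
    rw [hb0, div_lt_iff₀ (by linarith)]
    linarith
  have hb0pos : 0 < b0 := hs0pos.trans hs0b0
  have hv : 0 < v := by linarith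
  set f : ℝ → ℝ := fun s ↦ v * (s / s0) ^ γm - (K - s) with hf
  have hconv : StrictConvexOn ℝ (Set.Ioi 0) f := by
    refine ⟨convex_Ioi 0, fun x hx y hy hxy a b ha hb hab ↦ ?_⟩
    have hpow := (strictConvexOn_rpow_of_neg hγm).2 (div_pos hx hs0pos : x / s0 ∈ Set.Ioi 0)
      (div_pos hy hs0pos : y / s0 ∈ Set.Ioi 0) (by simpa [div_left_inj' hs0pos.ne'] using hxy)
      ha hb hab
    simp only [hf, smul_eq_mul] at hpow ⊢
    rw [show (a * x + b * y) / s0 = a * (x / s0) + b * (y / s0) by ring]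
    have hK' : K = a * K + b * K := by rw [← add_mul, hab, one_mul]
    linarith [mul_lt_mul_of_pos_left hpow hv]
  have hcont : ContinuousOn f (Set.Ioi 0) := by
    refine ContinuousOn.sub (ContinuousOn.mul continuousOn_const ?_) (by fun_prop)
    exact ContinuousOn.rpow_const (by fun_prop) fun x hx ↦ Or.inl (div_pos hx hs0pos).ne'
  have hfs0 : 0 < f s0 := by
    simp only [hf, div_self hs0pos.ne', one_rpow]
    linarith
  have hfb0 : f b0 < 0 := by
    have hpos : 0 < (b0 / s0) ^ γm := rpow_pos_of_pos (by positivity) _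
    have hinv : (s0 / b0) ^ γm * (b0 / s0) ^ γm = 1 := by
      rw [← mul_rpow (by positivity) (by positivity), div_mul_div_cancel₀ hb0pos.ne',
        div_self hs0pos.ne', one_rpow]
    have hlt := mul_lt_mul_of_pos_right hv2 hpos
    rw [mul_assoc, hinv, mul_one] at hlt
    simpa only [hf, sub_neg] using hlt
  have hfK : 0 < f K := by
    simp only [hf, sub_self, sub_zero]
    positivity
  obtain ⟨s1, ⟨hs01, hs1b⟩, hfs1⟩ := intermediate_value_Ioo' hs0b0.le
    (hcont.mono fun x hx ↦ hs0pos.trans_le hx.1) ⟨hfb0, hfs0⟩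
  obtain ⟨s2, ⟨hbs2, hs2K⟩, hfs2⟩ := intermediate_value_Ioo hb0K.le
    (hcont.mono fun x hx ↦ hb0pos.trans_le hx.1) ⟨hfb0, hfK⟩
  have hs1 : s1 ∈ Set.Ioi (0 : ℝ) := hs0pos.trans hs01
  have hs2 : s2 ∈ Set.Ioi (0 : ℝ) := hb0pos.trans hbs2
  refine ⟨s1, s2, hs01, hs1b, hbs2, hs2K, sub_eq_zero.1 hfs1, sub_eq_zero.1 hfs2, ?_, ?_⟩
  · intro s hs0s _ heq
    have hs : s ∈ Set.Ioi (0 : ℝ) := hs0pos.trans hs0s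
    have hfs : f s = 0 := sub_eq_zero.2 heq
    rcases lt_trichotomy s s1 with h1 | h1 | h1
    · exact absurd hfs1
        (hconv.neg_of_eq_zero_of_eq_zero hs hs2 hfs hfs2 h1 (hs1b.trans hbs2)).ne
    · exact Or.inl h1
    rcases lt_trichotomy s s2 with h2 | h2 | h2
    · exact absurd hfs (hconv.neg_of_eq_zero_of_eq_zero hs1 hs2 hfs1 hfs2 h1 h2).ne
    · exact Or.inr h2
    · exact absurd hfs2
        (hconv.neg_of_eq_zero_of_eq_zero hs1 hs hfs1 hfs (hs1b.trans hbs2) h2).ne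
  · intro s h1 h2
    exact sub_neg.1 (hconv.neg_of_eq_zero_of_eq_zero hs1 hs2 hfs1 hfs2 h1 h2)
end

section
/- Let σ0 > 0, α > 0, μ0 ∈ ℝ, K > 0, let γ⁻ be the negative real root of (1/2)σ0²γ² + (μ0 − (1/2)σ0²)γ − α = 0, set b0 := −γ⁻K/(1−γ⁻), and suppose 0 < s0 < b0. Let v ∈ ℝ satisfy K − s0 < v < (K − b0)(s0/b0)^{γ⁻}, and let s1 ∈ (s0, b0) be the smaller of the two solutions in (s0,K) of v·(s/s0)^{γ⁻} = K − s. Then the derivative of s ↦ v·(s/s0)^{γ⁻} at s1 is strictly less than −1, i.e. v γ⁻ s1^{γ⁻ − 1} s0^{−γ⁻} < −1. -/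
open Real

/-- In the proof of Lemma 2.3: at the smaller intersection point s1, the strictly convex
curve v(·/s0)^{γ⁻} crosses the line K − s with slope strictly less than −1. -/
theorem stmt_6 (σ0 α μ0 K γm s0 v s1 : ℝ) (hσ0 : 0 < σ0) (hα : 0 < α) (hK : 0 < K)
    (hγm : γm < 0)
    (hroot : (1/2) * σ0^2 * γm^2 + (μ0 - (1/2) * σ0^2) * γm - α = 0)
    (b0 : ℝ) (hb0 : b0 = -γm * K / (1 - γm))
    (hs0pos : 0 < s0) (hs0b0 : s0 < b0)
    (hv1 : K - s0 < v) (hv2 : v < (K - b0) * (s0 / b0) ^ γm)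
    (hs1l : s0 < s1) (hs1r : s1 < b0)
    (hs1eq : v * (s1 / s0) ^ γm = K - s1) :
    v * γm * s1 ^ (γm - 1) * s0 ^ (-γm) < -1 := by
  have hs1 : 0 < s1 := hs0pos.trans hs1l
  have hslope : v * γm * s1 ^ (γm - 1) * s0 ^ (-γm) = γm * (K - s1) / s1 := by
    rw [← hs1eq, div_rpow hs1.le hs0pos.le, rpow_sub_one hs1.ne', rpow_neg hs0pos.le]
    ring
  rw [hb0, lt_div_iff₀ (by linarith)] at hs1r
  rw [hslope, div_lt_iff₀ hs1]
  linarith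
end

section
/- Let σ0 > 0, α > 0, μ0 ∈ ℝ, K > 0, let γ⁺ > 0 and γ⁻ < 0 be the two real roots of (1/2)σ0²γ² + (μ0 − (1/2)σ0²)γ − α = 0, set b0 := −γ⁻K/(1−γ⁻), and suppose 0 < s0 < b0. Let v ∈ ℝ satisfy K − s0 < v < (K − b0)(s0/b0)^{γ⁻}, and let s1 ∈ (s0, b0) be the smaller solution in (s0,K) of v·(s/s0)^{γ⁻} = K − s. For b ∈ (s1, b0) define e1 := (v b^{γ⁻} − (K−b) s0^{γ⁻}) / (s0^{γ⁺} b^{γ⁻} − s0^{γ⁻} b^{γ⁺}) and e2 := (−v b^{γ⁺} + (K−b) s0^{γ⁺}) / (s0^{γ⁺} b^{γ⁻} − s0^{γ⁻} b^{γ⁺}). Then e1 > 0 and e2 > 0. -/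
open Real

/-- The function `x ↦ (K - x) * x ^ p` increases on `(0, p K / (1 + p))`. -/
theorem strictMonoOn_sub_mul_rpow {K p : ℝ} (hp : 0 < p) :
    StrictMonoOn (fun x : ℝ => (K - x) * x ^ p) (Set.Ioo 0 (p * K / (1 + p))) := by
  have hderiv : ∀ x : ℝ, 0 < x → HasDerivAt (fun x : ℝ => (K - x) * x ^ p)
      (-1 * x ^ p + (K - x) * (p * x ^ (p - 1))) x := fun x hx =>
    ((hasDerivAt_id' x).const_sub K).mul (hasDerivAt_rpow_const (Or.inl hx.ne'))
  refine strictMonoOn_of_deriv_pos (convex_Ioo _ _)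
    (fun x hx => (hderiv x hx.1).continuousAt.continuousWithinAt) fun x hx => ?_
  rw [interior_Ioo] at hx
  rw [(hderiv x hx.1).deriv]
  have hlt : x * (1 + p) < p * K := (lt_div_iff₀ (by linarith)).mp hx.2
  have hfactor : -1 * x ^ p + (K - x) * (p * x ^ (p - 1))
      = x ^ (p - 1) * (p * K - x * (1 + p)) := by
    have hpow : x ^ p = x ^ (p - 1) * x := by
      rw [← rpow_add_one hx.1.ne', sub_add_cancel]
    rw [hpow]; ring
  rw [hfactor]
  exact mul_pos (rpow_pos_of_pos hx.1 _) (by linarith)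

/-- Second part of the proof of Lemma 2.3: the coefficients e1, e2 of the candidate value
function on (s0, b) are both positive for any b between s1 and b0. -/
theorem stmt_8 (σ0 α μ0 K γp γm s0 v s1 b : ℝ)
    (hσ0 : 0 < σ0) (hα : 0 < α) (hK : 0 < K)
    (hγp : 0 < γp) (hγm : γm < 0)
    (hrootp : (1/2) * σ0^2 * γp^2 + (μ0 - (1/2) * σ0^2) * γp - α = 0)
    (hrootm : (1/2) * σ0^2 * γm^2 + (μ0 - (1/2) * σ0^2) * γm - α = 0)
    (b0 : ℝ) (hb0 : b0 = -γm * K / (1 - γm))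
    (hs0pos : 0 < s0) (hs0b0 : s0 < b0)
    (hv1 : K - s0 < v) (hv2 : v < (K - b0) * (s0 / b0) ^ γm)
    (hs1l : s0 < s1) (hs1r : s1 < b0)
    (hs1eq : v * (s1 / s0) ^ γm = K - s1)
    (hbl : s1 < b) (hbr : b < b0)
    (e1 e2 : ℝ)
    (he1 : e1 = (v * b ^ γm - (K - b) * s0 ^ γm) / (s0 ^ γp * b ^ γm - s0 ^ γm * b ^ γp))
    (he2 : e2 = (-v * b ^ γp + (K - b) * s0 ^ γp) / (s0 ^ γp * b ^ γm - s0 ^ γm * b ^ γp)) :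
    0 < e1 ∧ 0 < e2 := by
  have hs1pos : 0 < s1 := hs0pos.trans hs1l
  have hbpos : 0 < b := hs1pos.trans hbl
  have hb0K : b0 < K := by
    rw [hb0, div_lt_iff₀ (by linarith)]; nlinarith
  have hpp : s0 ^ γp < b ^ γp := rpow_lt_rpow hs0pos.le (by linarith) hγp
  have hmm : b ^ γm < s0 ^ γm := rpow_lt_rpow_of_neg hs0pos (by linarith) hγm
  have hbm : 0 < b ^ γm := rpow_pos_of_pos hbpos _
  have hs0p : 0 < s0 ^ γp := rpow_pos_of_pos hs0pos _
  have hs0m : 0 < s0 ^ γm := rpow_pos_of_pos hs0pos _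
  have hdet : s0 ^ γp * b ^ γm - s0 ^ γm * b ^ γp < 0 := by
    have := mul_lt_mul'' hpp hmm hs0p.le hbm.le
    linarith
  have hmono : (K - s1) * s1 ^ (-γm) < (K - b) * b ^ (-γm) := by
    have hb0' : -γm * K / (1 + -γm) = b0 := by rw [hb0, sub_eq_add_neg]
    refine strictMonoOn_sub_mul_rpow (neg_pos.mpr hγm) ⟨hs1pos, ?_⟩ ⟨hbpos, ?_⟩ hbl <;>
      rwa [hb0']
  have hvs1 : (K - s1) * s1 ^ (-γm) * s0 ^ γm = v := by
    have hs1m : 0 < s1 ^ γm := rpow_pos_of_pos hs1pos _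
    rw [← hs1eq, div_rpow hs1pos.le hs0pos.le, rpow_neg hs1pos.le]
    field_simp
  have hnum1 : v * b ^ γm - (K - b) * s0 ^ γm < 0 := by
    have h := mul_lt_mul_of_pos_right hmono (mul_pos hs0m hbm)
    have hcancel : b ^ (-γm) * b ^ γm = 1 := by
      rw [← rpow_add hbpos, neg_add_cancel, rpow_zero]
    have hright : (K - b) * b ^ (-γm) * (s0 ^ γm * b ^ γm) = (K - b) * s0 ^ γm := by
      linear_combination (K - b) * s0 ^ γm * hcancel
    rw [hright, ← mul_assoc, hvs1] at h
    linarith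
  have hnum2 : -v * b ^ γp + (K - b) * s0 ^ γp < 0 := by
    have := mul_lt_mul'' (show K - b < v by linarith) hpp (by linarith) hs0p.le
    linarith
  rw [he1, he2]
  exact ⟨div_pos_of_neg_of_neg hnum1 hdet, div_pos_of_neg_of_neg hnum2 hdet⟩
end

section
/- Let σ0 > 0, α > 0, μ0 ∈ ℝ, K > 0, let γ⁺ > 0 and γ⁻ < 0 be the two real roots of (1/2)σ0²γ² + (μ0 − (1/2)σ0²)γ − α = 0, set b0 := −γ⁻K/(1−γ⁻), and suppose 0 < s0 < b0. Let v ∈ ℝ satisfy K − s0 < v < (K − b0)(s0/b0)^{γ⁻}. Then there exist real numbers e1* > 0, e2* > 0 and a stopping level b* ∈ (s0, b0) such that: (1) v = e1* s0^{γ⁺} + e2* s0^{γ⁻}; (2) e1* b*^{γ⁺} + e2* b*^{γ⁻} = K − b*; (3) e1* γ⁺ b*^{γ⁺} + e2* γ⁻ b*^{γ⁻} = −b*; and (4) e1* s^{γ⁺} + e2* s^{γ⁻} > K − s for all s ∈ (s0, b*). -/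
open Real

/-- Bernoulli-type lower bound for real powers in terms of the logarithm. -/
lemma one_add_mul_log_le_rpow {t : ℝ} (ht : 0 < t) (p : ℝ) : 1 + p * log t ≤ t ^ p := by
  rw [rpow_def_of_pos ht]
  linarith [add_one_le_exp (log t * p)]

/-- A nonnegative combination of two powers of `t`, plus a positive multiple of `t`, whose
derivative at `1` vanishes has a strict minimum at `1`. -/
lemma add_lt_rpow_combination {A B b p m t : ℝ} (hA : 0 ≤ A) (hB : 0 ≤ B) (hb : 0 < b)
    (hslope : p * A + m * B = -b) (ht : 0 < t) (ht1 : t ≠ 1) :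
    A + B + b < A * t ^ p + B * t ^ m + b * t := by
  have h1 := mul_le_mul_of_nonneg_left (one_add_mul_log_le_rpow ht p) hA
  have h2 := mul_le_mul_of_nonneg_left (one_add_mul_log_le_rpow ht m) hB
  have h3 := mul_lt_mul_of_pos_left (log_lt_sub_one_of_pos ht ht1) hb
  linear_combination h1 + h2 + h3 - log t * hslope

/-- Lemma 2.3 (existence part): there exist positive coefficients e1*, e2* and a stopping
level b* ∈ (s0, b0) satisfying the value-matching and smooth-fit conditions and strict
domination of the gain function on (s0, b*). -/
theorem stmt_10 (σ0 α μ0 K γp γm s0 v : ℝ)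
    (hσ0 : 0 < σ0) (hα : 0 < α) (hK : 0 < K)
    (hγp : 0 < γp) (hγm : γm < 0)
    (hrootp : (1/2) * σ0^2 * γp^2 + (μ0 - (1/2) * σ0^2) * γp - α = 0)
    (hrootm : (1/2) * σ0^2 * γm^2 + (μ0 - (1/2) * σ0^2) * γm - α = 0)
    (b0 : ℝ) (hb0 : b0 = -γm * K / (1 - γm))
    (hs0pos : 0 < s0) (hs0b0 : s0 < b0)
    (hv1 : K - s0 < v) (hv2 : v < (K - b0) * (s0 / b0) ^ γm) :
    ∃ e1 e2 bs : ℝ, 0 < e1 ∧ 0 < e2 ∧ s0 < bs ∧ bs < b0 ∧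
      v = e1 * s0 ^ γp + e2 * s0 ^ γm ∧
      e1 * bs ^ γp + e2 * bs ^ γm = K - bs ∧
      e1 * γp * bs ^ γp + e2 * γm * bs ^ γm = -bs ∧
      (∀ s : ℝ, s0 < s → s < bs → e1 * s ^ γp + e2 * s ^ γm > K - s) := by
  have hd : 0 < γp - γm := by linarith
  have hm1 : 0 < 1 - γm := by linarith
  have hb0' : b0 * (1 - γm) = -γm * K := by rw [hb0]; field_simp
  have hb0K : b0 < K := by nlinarith
  -- the two components, at `b`, of the solution of the value-matching and smooth-fit equations
  let A : ℝ → ℝ := fun b => (-b - γm * (K - b)) / (γp - γm)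
  let B : ℝ → ℝ := fun b => (γp * (K - b) + b) / (γp - γm)
  have hsum (b : ℝ) : A b + B b = K - b := by
    simp only [A, B]; field_simp; ring
  have hslope (b : ℝ) : γp * A b + γm * B b = -b := by
    simp only [A, B]; field_simp; ring
  have hAb0 : A b0 = 0 := by
    simp only [A]; rw [div_eq_zero_iff]; left; linarith
  obtain ⟨b, ⟨hsb, hbb0⟩, hGb⟩ : ∃ b ∈ Set.Ioo s0 b0,
      A b * (s0 / b) ^ γp + B b * (s0 / b) ^ γm = v := by
    have hcont : ContinuousOn (fun b => A b * (s0 / b) ^ γp + B b * (s0 / b) ^ γm)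
        (Set.Icc s0 b0) := by
      have hpos : ∀ b ∈ Set.Icc s0 b0, b ≠ 0 := fun b hb => (hs0pos.trans_le hb.1).ne'
      have hq : ContinuousOn (fun b => s0 / b) (Set.Icc s0 b0) :=
        continuousOn_const.div continuousOn_id hpos
      have hr (p : ℝ) : ContinuousOn (fun b => (s0 / b) ^ p) (Set.Icc s0 b0) :=
        hq.rpow_const fun b hb => Or.inl (div_ne_zero hs0pos.ne' (hpos b hb))
      have hA : Continuous A := by fun_prop
      have hB : Continuous B := by fun_prop
      exact (hA.continuousOn.mul (hr γp)).add (hB.continuousOn.mul (hr γm))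
    apply intermediate_value_Ioo hs0b0.le hcont
    have hBb0 : B b0 = K - b0 := by linarith [hsum b0]
    simpa [div_self hs0pos.ne', hsum, hAb0, hBb0] using And.intro hv1 hv2
  have hb : 0 < b := hs0pos.trans hsb
  have hA : 0 < A b := div_pos (by nlinarith) hd
  have hB : 0 < B b := div_pos (by nlinarith [mul_pos hγp (sub_pos.2 (hbb0.trans hb0K))]) hd
  have hbp (p : ℝ) : b ^ p ≠ 0 := (rpow_pos_of_pos hb p).ne'
  have hscale (C p : ℝ) {s : ℝ} (hs : 0 < s) : C / b ^ p * s ^ p = C * (s / b) ^ p := by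
    rw [div_rpow hs.le hb.le]; ring
  refine ⟨A b / b ^ γp, B b / b ^ γm, b, div_pos hA (rpow_pos_of_pos hb _),
    div_pos hB (rpow_pos_of_pos hb _), hsb, hbb0, ?_, ?_, ?_, fun s hs0s hsb' => ?_⟩
  · rw [hscale _ _ hs0pos, hscale _ _ hs0pos, hGb]
  · rw [div_mul_cancel₀ _ (hbp _), div_mul_cancel₀ _ (hbp _), hsum]
  · rw [mul_right_comm, mul_right_comm _ γm, div_mul_cancel₀ _ (hbp _),
      div_mul_cancel₀ _ (hbp _), ← hslope b]
    ring
  · have hs : 0 < s := hs0pos.trans hs0s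
    have hlt := add_lt_rpow_combination hA.le hB.le hb (hslope b) (div_pos hs hb)
      ((div_lt_one hb).2 hsb').ne
    rw [mul_div_cancel₀ _ hb.ne'] at hlt
    rw [hscale _ _ hs, hscale _ _ hs]
    linarith [hsum b]
end

section
/- Let σ0 > 0, α > 0, μ0 ∈ ℝ, K > 0, let γ⁺ > 0 and γ⁻ < 0 be the two real roots of (1/2)σ0²γ² + (μ0 − (1/2)σ0²)γ − α = 0, set b0 := −γ⁻K/(1−γ⁻), and suppose 0 < s0 < b0. For v ∈ ℝ and s > s0 define g(v, s) := [v s^{γ⁺+γ⁻−1}(γ⁺ − γ⁻) + (K − s) s^{−1}(γ⁻ s0^{γ⁺} s^{γ⁻} − γ⁺ s0^{γ⁻} s^{γ⁺})] / (s0^{γ⁺} s^{γ⁻} − s0^{γ⁻} s^{γ⁺}). Then the function v ↦ g(v, b0) is strictly decreasing on ℝ, and g((K − b0)(s0/b0)^{γ⁻}, b0) = −1; consequently, g(v, b0) > −1 for every v < (K − b0)(s0/b0)^{γ⁻}. -/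
open Real

/-- For exponents `q < 0 < p` and `0 < x < y`, the determinant `x ^ p * y ^ q - x ^ q * y ^ p`
of the two power solutions is negative. -/
theorem rpow_mul_rpow_sub_rpow_mul_rpow_neg {x y p q : ℝ} (hx : 0 < x) (hxy : x < y)
    (hp : 0 < p) (hq : q < 0) : x ^ p * y ^ q - x ^ q * y ^ p < 0 := by
  have hpow : x ^ p < y ^ p := rpow_lt_rpow hx.le hxy hp
  have hpow' : y ^ q < x ^ q := rpow_lt_rpow_of_neg hx hxy hq
  rw [sub_neg, mul_comm (x ^ q)]
  exact mul_lt_mul'' hpow hpow' (rpow_nonneg hx.le p) (rpow_nonneg (hx.trans hxy).le q)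

/-- Intermediate-value step in the proof of Lemma 2.3: the function v ↦ g(v, b0) is
strictly decreasing, equals −1 at v = (K − b0)(s0/b0)^{γ⁻}, hence exceeds −1 for
smaller v. -/
theorem stmt_11 (σ0 α μ0 K γp γm s0 : ℝ)
    (hσ0 : 0 < σ0) (hα : 0 < α) (hK : 0 < K)
    (hγp : 0 < γp) (hγm : γm < 0)
    (hrootp : (1/2) * σ0^2 * γp^2 + (μ0 - (1/2) * σ0^2) * γp - α = 0)
    (hrootm : (1/2) * σ0^2 * γm^2 + (μ0 - (1/2) * σ0^2) * γm - α = 0)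
    (b0 : ℝ) (hb0 : b0 = -γm * K / (1 - γm))
    (hs0pos : 0 < s0) (hs0b0 : s0 < b0)
    (g : ℝ → ℝ → ℝ)
    (hg : ∀ v s : ℝ, g v s =
      (v * s ^ (γp + γm - 1) * (γp - γm)
        + (K - s) * s⁻¹ * (γm * s0 ^ γp * s ^ γm - γp * s0 ^ γm * s ^ γp))
      / (s0 ^ γp * s ^ γm - s0 ^ γm * s ^ γp)) :
    StrictAnti (fun v : ℝ => g v b0) ∧
    g ((K - b0) * (s0 / b0) ^ γm) b0 = -1 ∧
    (∀ v : ℝ, v < (K - b0) * (s0 / b0) ^ γm → g v b0 > -1) := by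
  have hb : 0 < b0 := hs0pos.trans hs0b0
  have hD := rpow_mul_rpow_sub_rpow_mul_rpow_neg hs0pos hs0b0 hγp hγm
  have hanti : StrictAnti (fun v : ℝ => g v b0) := by
    intro v w hvw
    simp only [hg]
    apply div_lt_div_of_neg_of_lt hD
    have hpow : 0 < b0 ^ (γp + γm - 1) := rpow_pos_of_pos hb _
    have hγ : 0 < γp - γm := by linarith
    gcongr
  have hval : g ((K - b0) * (s0 / b0) ^ γm) b0 = -1 := by
    have hM : b0 ^ γm ≠ 0 := (rpow_pos_of_pos hb γm).ne'
    have hfit : γm * (K - b0) = -b0 := by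
      have h1 : 1 - γm ≠ 0 := by linarith
      rw [hb0]
      field_simp
      ring
    rw [hg, div_eq_iff hD.ne, div_rpow hs0pos.le hb.le, rpow_sub_one hb.ne', rpow_add hb]
    field_simp
    linear_combination (s0 ^ γp * b0 ^ γm - s0 ^ γm * b0 ^ γp) * hfit
  exact ⟨hanti, hval, fun v hv => hval ▸ hanti hv⟩
end

section
/- Let σ0 > 0, α > 0, μ0 ∈ ℝ, K > 0, let γ⁻ be the negative real root of (1/2)σ0²γ² + (μ0 − (1/2)σ0²)γ − α = 0, and set b0 := −γ⁻K/(1−γ⁻). Then for every s with 0 < s ≤ b0 one has α(K − s) + μ0 s ≥ 0; equivalently, the function K − s satisfies (L − αI)(K − ·)(s) = −μ0 s − α(K − s) ≤ 0 on (0, b0]. -/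
open Real

/-- Verification of (v2) in the proof of Theorem 1.5(iv): on (0, b0] the gain function
K − s satisfies (L − αI)(K − ·)(s) = −μ0 s − α(K − s) ≤ 0. -/
theorem stmt_12 (σ0 α μ0 K γm : ℝ) (hσ0 : 0 < σ0) (hα : 0 < α) (hK : 0 < K)
    (hγm : γm < 0)
    (hroot : (1/2) * σ0^2 * γm^2 + (μ0 - (1/2) * σ0^2) * γm - α = 0)
    (b0 : ℝ) (hb0 : b0 = -γm * K / (1 - γm)) :
    ∀ s : ℝ, 0 < s → s ≤ b0 →
      0 ≤ α * (K - s) + μ0 * s ∧ -(μ0 * s) - α * (K - s) ≤ 0 := by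
  intro s hs hsb
  have hs_mul : s * (1 - γm) ≤ -γm * K := by
    rwa [hb0, le_div_iff₀ (by linarith)] at hsb
  have hdrift : 0 ≤ α - μ0 * γm := by
    have h : 0 ≤ σ0 ^ 2 * (γm ^ 2 - γm) :=
      mul_nonneg (sq_nonneg _) (by linarith [sq_nonneg γm])
    linarith
  have hscaled : 0 ≤ -γm * (α * (K - s) + μ0 * s) := by
    linarith [mul_le_mul_of_nonneg_left hs_mul hα.le, mul_nonneg hs.le hdrift]
  have hgain : 0 ≤ α * (K - s) + μ0 * s :=
    nonneg_of_mul_nonneg_right hscaled (neg_pos.mpr hγm)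
  exact ⟨hgain, by linarith⟩
end

section
/- Let σ1 > 0, α > 0, λ > 0, μ1 ∈ ℝ with α + λ ≠ μ1, and K > 0. Let β⁺ > 0 and β⁻ < 0 be the two real roots of (1/2)σ1²β² + (μ1 − (1/2)σ1²)β − (α + λ) = 0. Define c1 := (λ K^{1−β⁺}/(β⁻ − β⁺)) · [β⁻/(α + λ − μ1) − β⁻/(α + λ) − 1/(α + λ − μ1)] and, for b > 0, Γ(b) := c1 b^{β⁺−1}(β⁺ − β⁻) + αKβ⁻/((α + λ) b) − ((α − μ1)β⁻ + λ)/(α + λ − μ1). Then: (i) Γ(b) → −∞ as b → 0⁺; (ii) Γ(K) = 0; and (iii) Γ'(b) ≠ 0 for every b > 0. Consequently Γ is strictly increasing on (0, ∞) and there exists exactly one b1 ∈ (0, K) with Γ(b1) = −1. -/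
open Real Filter Set

/-- A function `C * b ^ (p - 1) - E / b - F` with `p, E > 0` tends to `-∞` at `0⁺`. -/
theorem tendsto_rpow_sub_div_atBot {C E F p : ℝ} (hp : 0 < p) (hE : 0 < E) :
    Tendsto (fun b : ℝ => C * b ^ (p - 1) - E / b - F) (nhdsWithin 0 (Ioi 0)) atBot := by
  have hcont : ContinuousAt (fun b : ℝ => C * b ^ p - E - F * b) 0 := by
    have := Real.continuousAt_rpow_const 0 p (Or.inr hp.le)
    fun_prop
  have hlim : Tendsto (fun b : ℝ => C * b ^ p - E - F * b) (nhdsWithin 0 (Ioi 0))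
      (nhds (-E)) := by
    have h := hcont.tendsto.mono_left (nhdsWithin_le_nhds (s := Ioi (0 : ℝ)))
    simpa [Real.zero_rpow hp.ne'] using h
  refine (hlim.neg_mul_atTop (neg_lt_zero.mpr hE) tendsto_inv_nhdsGT_zero).congr' ?_
  filter_upwards [self_mem_nhdsWithin] with b hb
  have hb : (0 : ℝ) < b := hb
  rw [Real.rpow_sub_one hb.ne']
  field_simp

/-- The derivative of `C * b ^ (p - 1) - E / b - F` at a nonzero point. -/
theorem hasDerivAt_rpow_sub_div {C E F p b : ℝ} (hb : b ≠ 0) :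
    HasDerivAt (fun b : ℝ => C * b ^ (p - 1) - E / b - F)
      (C * (p - 1) * b ^ (p - 1 - 1) + E / b ^ 2) b := by
  have h := (((Real.hasDerivAt_rpow_const (p := p - 1) (Or.inl hb)).const_mul C).sub
    ((hasDerivAt_inv hb).const_mul E)).sub_const F
  refine (h.congr_of_eventuallyEq (.of_forall fun x => ?_)).congr_deriv ?_
  · simp [div_eq_mul_inv]
  · ring

/-- Vieta's product formula for `s * x ^ 2 + m * x - A` with distinct roots `p` and `q`. -/
theorem mul_mul_eq_neg_of_roots {s m A p q : ℝ} (hpq : p ≠ q)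
    (hp : s * p ^ 2 + m * p - A = 0) (hq : s * q ^ 2 + m * q - A = 0) :
    s * (p * q) = -A := by
  apply mul_left_cancel₀ (sub_ne_zero.mpr hpq)
  linear_combination q * hp - p * hq

/-- Proof of Lemma A.3: the function Γ (the slope at b of the candidate value function
with stopping level b) tends to −∞ at 0⁺, vanishes at K, has nonvanishing derivative,
is strictly increasing on (0, ∞), and hence Γ(b) = −1 has exactly one root in (0, K). -/
theorem stmt_16 (σ1 α lam μ1 K βp βm : ℝ)
    (hσ1 : 0 < σ1) (hα : 0 < α) (hlam : 0 < lam) (hne : α + lam ≠ μ1) (hK : 0 < K)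
    (hβp : 0 < βp) (hβm : βm < 0)
    (hrootp : (1/2) * σ1^2 * βp^2 + (μ1 - (1/2) * σ1^2) * βp - (α + lam) = 0)
    (hrootm : (1/2) * σ1^2 * βm^2 + (μ1 - (1/2) * σ1^2) * βm - (α + lam) = 0)
    (c1 : ℝ)
    (hc1 : c1 = lam * K ^ (1 - βp) / (βm - βp) *
      (βm / (α + lam - μ1) - βm / (α + lam) - 1 / (α + lam - μ1)))
    (Γ : ℝ → ℝ)
    (hΓ : ∀ b : ℝ, Γ b = c1 * b ^ (βp - 1) * (βp - βm)
      + α * K * βm / ((α + lam) * b) - ((α - μ1) * βm + lam) / (α + lam - μ1)) :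
    Tendsto Γ (nhdsWithin 0 (Ioi 0)) atBot ∧
    Γ K = 0 ∧
    (∀ b : ℝ, 0 < b → deriv Γ b ≠ 0) ∧
    StrictMonoOn Γ (Ioi 0) ∧
    (∃! b1 : ℝ, b1 ∈ Ioo 0 K ∧ Γ b1 = -1) := by
  have hA : 0 < α + lam := by positivity
  have hD : α + lam - μ1 ≠ 0 := sub_ne_zero.mpr hne
  have hpm : βm - βp ≠ 0 := by linarith
  have hprod := mul_mul_eq_neg_of_roots (by linarith : βp ≠ βm) hrootp hrootm
  have hprod_one : 1 / 2 * σ1 ^ 2 * ((1 - βm) * (βp - 1)) = α + lam - μ1 := by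
    apply mul_left_cancel₀ hpm
    linear_combination hrootm - hrootp - (βm - βp) * hprod
  set C := c1 * (βp - βm) with hC
  set E := -(α * K * βm / (α + lam)) with hE
  set F := ((α - μ1) * βm + lam) / (α + lam - μ1) with hF
  have hE0 : 0 < E := by
    rw [hE, neg_pos]
    exact div_neg_of_neg_of_pos (mul_neg_of_pos_of_neg (by positivity) hβm) hA
  have hΓ' : Γ = fun b => C * b ^ (βp - 1) - E / b - F := by
    funext b
    rw [hΓ, hC, hE, ← div_div]
    ring
  have hCeq : C = lam * K ^ (1 - βp) * ((1 - βm) / (α + lam - μ1) + βm / (α + lam)) := by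
    rw [hC, hc1]
    field_simp
    ring
  have hCp : C * (βp - 1) = lam * K ^ (1 - βp) * (-βm / (α + lam)) := by
    have h : ((1 - βm) / (α + lam - μ1) + βm / (α + lam)) * (βp - 1) = -βm / (α + lam) := by
      field_simp
      linear_combination (βm + βp - βp * βm - 1) * hprod - βp * βm * hprod_one
    rw [hCeq, mul_assoc, h]
  have hCp0 : 0 < C * (βp - 1) := by
    rw [hCp]
    have : 0 < -βm := neg_pos.mpr hβm
    positivity
  have hderiv : ∀ b : ℝ, 0 < b → 0 < deriv Γ b := by
    intro b hb
    rw [hΓ', (hasDerivAt_rpow_sub_div hb.ne').deriv]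
    positivity
  have hcont : ContinuousOn Γ (Ioi 0) := by
    intro b hb
    rw [hΓ']
    exact (hasDerivAt_rpow_sub_div (ne_of_gt hb)).continuousAt.continuousWithinAt
  have hmono : StrictMonoOn Γ (Ioi 0) :=
    strictMonoOn_of_deriv_pos (convex_Ioi 0) hcont fun b hb => hderiv b (by simpa using hb)
  have hlim : Tendsto Γ (nhdsWithin 0 (Ioi 0)) atBot := by
    rw [hΓ']
    exact tendsto_rpow_sub_div_atBot hβp hE0
  have hΓK : Γ K = 0 := by
    have hpow : K ^ (1 - βp) * K ^ (βp - 1) = 1 := by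
      rw [← Real.rpow_add hK]
      simp
    have hCK : C * K ^ (βp - 1) = lam * ((1 - βm) / (α + lam - μ1) + βm / (α + lam)) := by
      rw [hCeq]
      linear_combination lam * ((1 - βm) / (α + lam - μ1) + βm / (α + lam)) * hpow
    rw [hΓ']
    simp only [hCK, hE, hF]
    field_simp
    ring
  refine ⟨hlim, hΓK, fun b hb => (hderiv b hb).ne', hmono, ?_⟩
  obtain ⟨a, ha, ha0, haK⟩ : ∃ a, Γ a < -1 ∧ 0 < a ∧ a < K :=
    ((hlim.eventually_lt_atBot (-1)).and (Ioo_mem_nhdsGT hK)).exists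
  obtain ⟨b, hb, hbΓ⟩ := intermediate_value_Ioo haK.le
    (hcont.mono fun x hx => ha0.trans_le hx.1) (show (-1 : ℝ) ∈ Ioo (Γ a) (Γ K) by
      rw [hΓK]
      exact ⟨ha, by norm_num⟩)
  exact ⟨b, ⟨⟨ha0.trans hb.1, hb.2⟩, hbΓ⟩, fun y hy =>
    hmono.injOn hy.1.1 (ha0.trans hb.1) (hy.2.trans hbΓ.symm)⟩
end

section
/- Let σ1 > 0, α > 0, λ > 0, μ1 ∈ ℝ with α + λ ≠ μ1, and K > 0. Let β⁺ > 0 and β⁻ < 0 be the two real roots of (1/2)σ1²β² + (μ1 − (1/2)σ1²)β − (α + λ) = 0, and let h(s) := −λs/(α + λ − μ1) + λK/(α + λ). Then there exists exactly one quadruple (c1, c2, d2, b1) ∈ ℝ³ × (0, K) satisfying the four equations: c1 K^{β⁺} + c2 K^{β⁻} + h(K) = d2 K^{β⁻}; c1 β⁺ K^{β⁺} + c2 β⁻ K^{β⁻} + K h'(K) = d2 β⁻ K^{β⁻}; K − b1 = c1 b1^{β⁺} + c2 b1^{β⁻} + h(b1); and −b1 = c1 β⁺ b1^{β⁺} + c2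 β⁻ b1^{β⁻} + b1 h'(b1). -/
open Real

/-- A convex function which is negative at the left endpoint and positive at the right endpoint of
an interval has exactly one zero in the interior. -/
lemma ConvexOn.existsUnique_zero {f : ℝ → ℝ} {a b : ℝ} (hab : a < b)
    (hf : ConvexOn ℝ (Set.Icc a b) f) (hc : ContinuousOn f (Set.Icc a b))
    (ha : f a < 0) (hb : 0 < f b) : ∃! x, x ∈ Set.Ioo a b ∧ f x = 0 := by
  have zero_le : ∀ x ∈ Set.Ioo a b, ∀ y ∈ Set.Ioo a b, f x = 0 → f y = 0 → y ≤ x := by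
    intro x hx y hy hfx hfy
    by_contra! hxy
    have h := hf.2 (Set.left_mem_Icc.2 hab.le) (Set.Ioo_subset_Icc_self hy)
      (show 0 ≤ (y - x) / (y - a) from div_nonneg (by linarith) (by linarith [hy.1]))
      (show 0 ≤ (x - a) / (y - a) from div_nonneg (by linarith [hx.1]) (by linarith [hy.1]))
      (by rw [← add_div, sub_add_sub_cancel, div_self (sub_pos.2 hy.1).ne'])
    have hcomb : ((y - x) / (y - a)) • a + ((x - a) / (y - a)) • y = x := by
      have := (sub_pos.2 hy.1).ne'
      simp only [smul_eq_mul]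
      field_simp
      ring
    rw [hcomb, hfx, hfy, smul_zero, add_zero, smul_eq_mul] at h
    have : (y - x) / (y - a) * f a < 0 :=
      mul_neg_of_pos_of_neg (div_pos (by linarith) (by linarith [hy.1])) ha
    linarith
  obtain ⟨x, hx, hfx⟩ := intermediate_value_Ioo hab.le hc ⟨ha, hb⟩
  exact ⟨x, ⟨hx, hfx⟩, fun y hy =>
    le_antisymm (zero_le x hx y hy.1 hfx hy.2) (zero_le y hy.1 x hx hy.2 hfx)⟩

/-- The function `x ↦ x ^ p / (p * (p - 1))`, with second derivative `x ^ (p - 2)`, is convex on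
`[0, ∞)` for every `p > 0`. -/
lemma convexOn_mul_rpow {p A : ℝ} (hp : 0 < p) (hA : 0 ≤ A) :
    ConvexOn ℝ (Set.Ici 0) fun x : ℝ => A / (p * (p - 1)) * x ^ p := by
  rcases le_total 1 p with h1 | h1
  · exact (convexOn_rpow h1).smul (div_nonneg hA (mul_nonneg hp.le (by linarith)))
  · have h := (concaveOn_rpow hp.le h1).neg.smul (c := -(A / (p * (p - 1))))
      (neg_nonneg.2 (div_nonpos_of_nonneg_of_nonpos hA
        (mul_nonpos_of_nonneg_of_nonpos hp.le (by linarith))))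
    refine h.congr fun x _ => ?_
    simp

/-- Lemma A.3: the system (99) of value-matching and smooth-fit conditions has exactly
one solution (c1, c2, d2, b1) with b1 ∈ (0, K). -/
theorem stmt_17 (σ1 α lam μ1 K βp βm : ℝ)
    (hσ1 : 0 < σ1) (hα : 0 < α) (hlam : 0 < lam) (hne : α + lam ≠ μ1) (hK : 0 < K)
    (hβp : 0 < βp) (hβm : βm < 0)
    (hrootp : (1/2) * σ1^2 * βp^2 + (μ1 - (1/2) * σ1^2) * βp - (α + lam) = 0)
    (hrootm : (1/2) * σ1^2 * βm^2 + (μ1 - (1/2) * σ1^2) * βm - (α + lam) = 0)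
    (h : ℝ → ℝ)
    (hh : ∀ s : ℝ, h s = -lam * s / (α + lam - μ1) + lam * K / (α + lam)) :
    ∃! q : ℝ × ℝ × ℝ × ℝ,
      0 < q.2.2.2 ∧ q.2.2.2 < K ∧
      q.1 * K ^ βp + q.2.1 * K ^ βm + h K = q.2.2.1 * K ^ βm ∧
      q.1 * βp * K ^ βp + q.2.1 * βm * K ^ βm + K * deriv h K = q.2.2.1 * βm * K ^ βm ∧
      K - q.2.2.2 = q.1 * q.2.2.2 ^ βp + q.2.1 * q.2.2.2 ^ βm + h q.2.2.2 ∧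
      -q.2.2.2 = q.1 * βp * q.2.2.2 ^ βp + q.2.1 * βm * q.2.2.2 ^ βm
        + q.2.2.2 * deriv h q.2.2.2 := by
  have hpm : βp - βm ≠ 0 := by linarith
  obtain ⟨s, hs⟩ : ∃ s, s = 1 / 2 * σ1 ^ 2 := ⟨_, rfl⟩
  have hs0 : 0 < s := by rw [hs]; positivity
  rw [← hs] at hrootp hrootm
  have hμ : μ1 = s - s * (βp + βm) := by
    have : (βp - βm) * (s * (βp + βm) + (μ1 - s)) = 0 := by linear_combination hrootp - hrootm
    linarith [(mul_eq_zero.1 this).resolve_left hpm]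
  have hr : α + lam = -(s * βp * βm) := by rw [hμ] at hrootp; linarith
  have hD : α + lam - μ1 = s * (βp - 1) * (1 - βm) := by rw [hr, hμ]; ring
  have hp1 : βp - 1 ≠ 0 := by
    intro h0
    rw [h0] at hD
    exact hne (by linarith)
  have hm0 : βm ≠ 0 := hβm.ne
  have hm1 : 1 - βm ≠ 0 := by linarith
  have hd : ∀ x, deriv h x = -lam / (s * (βp - 1) * (1 - βm)) := by
    intro x
    rw [← hD, funext hh]
    exact ((((hasDerivAt_id x).const_mul (-lam)).div_const _).add_const _).deriv.trans
      (by rw [mul_one])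
  simp_rw [hD, hr] at hh
  have hKp : 0 < K ^ βp := rpow_pos_of_pos hK _
  have hKm : 0 < K ^ βm := rpow_pos_of_pos hK _
  obtain ⟨C, hC⟩ : ∃ C, C = lam * K / (s * K ^ βp) / (βp * (βp - 1)) := ⟨_, rfl⟩
  have hCK : βm * h K - K * deriv h K = C * K ^ βp := by
    rw [hh, hd, hC]
    field_simp
    ring
  let G : ℝ → ℝ := fun b => C * b ^ βp +
    ((1 - βm - lam / (s * (βp - 1))) * b + (βm * K + lam * K / (s * βp)))
  have hG : ∀ b, G b = C * b ^ βp + b * deriv h b - βm * h b + b + βm * (K - b) := by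
    intro b
    simp only [G]
    rw [hh, hd]
    field_simp
    ring
  have hG0 : G 0 < 0 := by
    have : G 0 = -(α * K / (s * βp)) := by
      simp only [G]
      rw [zero_rpow hβp.ne', eq_sub_of_add_eq hr]
      field_simp
      ring
    rw [this]
    exact neg_neg_of_pos (by positivity)
  have hGK : 0 < G K := by
    rw [hG]
    linarith
  have hconv : ConvexOn ℝ (Set.Icc 0 K) G := by
    refine ConvexOn.subset ?_ Set.Icc_subset_Ici_self (convex_Icc 0 K)
    have hlin : ConvexOn ℝ (Set.Ici (0 : ℝ)) fun b : ℝ =>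
        (1 - βm - lam / (s * (βp - 1))) * b + (βm * K + lam * K / (s * βp)) :=
      (((LinearMap.mulLeft ℝ (1 - βm - lam / (s * (βp - 1)))).convexOn
        (convex_Ici 0)).add_const _)
    have := (convexOn_mul_rpow hβp (A := lam * K / (s * K ^ βp)) (by positivity)).add hlin
    rw [← hC] at this
    exact this
  have hcont : Continuous G :=
    (continuous_const.mul (continuous_id.rpow_const fun _ => Or.inr hβp.le)).add (by fun_prop)
  obtain ⟨b, ⟨⟨hb0, hbK⟩, hb⟩, huniq⟩ := hconv.existsUnique_zero hK hcont.continuousOn hG0 hGK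
  have hbm : 0 < b ^ βm := rpow_pos_of_pos hb0 _
  rw [hG] at hb
  obtain ⟨c1, hc1⟩ : ∃ c1, c1 * (βp - βm) = C := ⟨C / (βp - βm), div_mul_cancel₀ _ hpm⟩
  obtain ⟨c2, hc2⟩ : ∃ c2, c2 * b ^ βm = K - b - c1 * b ^ βp - h b :=
    ⟨_, div_mul_cancel₀ _ hbm.ne'⟩
  obtain ⟨d2, hd2⟩ : ∃ d2, d2 * K ^ βm = c1 * K ^ βp + c2 * K ^ βm + h K :=
    ⟨_, div_mul_cancel₀ _ hKm.ne'⟩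
  refine ⟨(c1, c2, d2, b), ⟨hb0, hbK, hd2.symm, ?_, by linarith, ?_⟩, ?_⟩
  · linear_combination -βm * hd2 - hCK + K ^ βp * hc1
  · linear_combination -hb - βm * hc2 - b ^ βp * hc1
  · rintro ⟨c1', c2', d2', b'⟩ ⟨hb0', hbK', e1, e2, e3, e4⟩
    dsimp only at hb0' hbK' e1 e2 e3 e4
    have hc1' : c1' * (βp - βm) = C :=
      mul_right_cancel₀ hKp.ne' (by linear_combination e2 - βm * e1 + hCK)
    obtain rfl : b' = b := huniq b' ⟨⟨hb0', hbK'⟩, by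
      rw [hG]
      linear_combination -e4 + βm * e3 - b' ^ βp * hc1'⟩
    obtain rfl : c1' = c1 := mul_right_cancel₀ hpm (hc1'.trans hc1.symm)
    obtain rfl : c2' = c2 := mul_right_cancel₀ hbm.ne' (by linarith)
    obtain rfl : d2' = d2 := mul_right_cancel₀ hKm.ne' (by linarith)
    rfl
end

section
/- There exists a bounded, convex, infinitely differentiable function g : (0, ∞) → ℝ with g(1/2) = 4, g'(1/2) = −8, g(1) = 1, g'(1) = −1, and g(x) = 0 for all x ≥ 3. Moreover, for any differentiable function g : (0, ∞) → ℝ satisfying g(1/2) = 4, g'(1/2) = −8, g(1) = 1 and g'(1) = −1, both pairs (c2, x0) = (1, 1) and (c2, x0) = (2, 1/2) satisfy the two equations g(x0) = c2·x0^{−1} and g'(x0) = −c2·x0^{−2}. -/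
open Real Set

noncomputable section

/-- The antiderivative of `Real.smoothTransition` vanishing at `0`: a smooth monotone
function which is `0` on `(-∞, 0]` and affine with slope `1` on `[1, ∞)`. -/
def smoothRamp (t : ℝ) : ℝ := ∫ s in (0 : ℝ)..t, smoothTransition s

namespace smoothRamp

theorem hasDerivAt (t : ℝ) : HasDerivAt smoothRamp (smoothTransition t) t :=
  (smoothTransition.continuous.integral_hasStrictDerivAt 0 t).hasDerivAt

theorem deriv_eq : deriv smoothRamp = smoothTransition :=
  funext fun t => (hasDerivAt t).deriv

theorem differentiable : Differentiable ℝ smoothRamp :=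
  fun t => (hasDerivAt t).differentiableAt

theorem contDiff : ContDiff ℝ (⊤ : ℕ∞) smoothRamp :=
  contDiff_infty_iff_deriv.2 ⟨differentiable, deriv_eq ▸ smoothTransition.contDiff⟩

theorem monotone : Monotone smoothRamp :=
  monotone_of_deriv_nonneg differentiable fun t => deriv_eq ▸ smoothTransition.nonneg t

theorem of_nonpos {t : ℝ} (ht : t ≤ 0) : smoothRamp t = 0 := by
  rw [smoothRamp, intervalIntegral.integral_congr (g := fun _ => 0)]
  · simp
  · intro s hs
    rw [uIcc_of_ge ht] at hs
    exact smoothTransition.zero_of_nonpos hs.2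

theorem nonneg (t : ℝ) : 0 ≤ smoothRamp t := by
  rcases le_total t 0 with h | h
  · exact (of_nonpos h).ge
  · simpa [of_nonpos le_rfl] using monotone h

theorem of_one_le {t : ℝ} (ht : 1 ≤ t) : smoothRamp t = t - 1 + smoothRamp 1 := by
  have hint (a b : ℝ) : IntervalIntegrable smoothTransition MeasureTheory.volume a b :=
    smoothTransition.continuous.intervalIntegrable a b
  have h : ∫ s in (1 : ℝ)..t, smoothTransition s = t - 1 := by
    rw [intervalIntegral.integral_congr (g := fun _ => 1)]
    · simp
    · intro s hs
      rw [uIcc_of_le ht] at hs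
      exact smoothTransition.one_of_one_le hs.1
  rw [smoothRamp, ← intervalIntegral.integral_add_adjacent_intervals (hint 0 1) (hint 1 t), h,
    add_comm, smoothRamp]

theorem one_le_one : smoothRamp 1 ≤ 1 := by
  have h := intervalIntegral.integral_mono_on (μ := MeasureTheory.volume) (zero_le_one' ℝ)
    (smoothTransition.continuous.intervalIntegrable 0 1) (continuous_const.intervalIntegrable 0 1)
    fun s _ => smoothTransition.le_one s
  simpa [smoothRamp] using h

end smoothRamp

/-- A smooth version of the convex piecewise linear function `max (8 - 8 x) (2 - x) 0`. -/
def smoothGain (x : ℝ) : ℝ :=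
  smoothRamp (7 - smoothRamp 1 - 7 * x) + smoothRamp (3 - smoothRamp 1 - x)

namespace smoothGain

theorem hasDerivAt (x : ℝ) : HasDerivAt smoothGain
    (smoothTransition (7 - smoothRamp 1 - 7 * x) * -7 +
      smoothTransition (3 - smoothRamp 1 - x) * -1) x := by
  have h₁ : HasDerivAt (fun y : ℝ => 7 - smoothRamp 1 - 7 * y) (-7) x := by
    simpa using ((hasDerivAt_id x).const_mul 7).const_sub (7 - smoothRamp 1)
  have h₂ : HasDerivAt (fun y : ℝ => 3 - smoothRamp 1 - y) (-1) x :=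
    (hasDerivAt_id x).const_sub (3 - smoothRamp 1)
  exact ((smoothRamp.hasDerivAt _).comp x h₁).add ((smoothRamp.hasDerivAt _).comp x h₂)

theorem contDiff : ContDiff ℝ (⊤ : ℕ∞) smoothGain :=
  (smoothRamp.contDiff.comp (by fun_prop)).add (smoothRamp.contDiff.comp (by fun_prop))

theorem convexOn : ConvexOn ℝ univ smoothGain := by
  refine Monotone.convexOn_univ_of_deriv (fun x => (hasDerivAt x).differentiableAt) ?_
  intro x y hxy
  rw [(hasDerivAt x).deriv, (hasDerivAt y).deriv]
  have h₁ := smoothTransition.monotone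
    (show 7 - smoothRamp 1 - 7 * y ≤ 7 - smoothRamp 1 - 7 * x by linarith)
  have h₂ := smoothTransition.monotone
    (show 3 - smoothRamp 1 - y ≤ 3 - smoothRamp 1 - x by linarith)
  linarith

theorem abs_le {x : ℝ} (hx : 0 < x) : |smoothGain x| ≤ smoothGain 0 := by
  rw [smoothGain, abs_of_nonneg (add_nonneg (smoothRamp.nonneg _) (smoothRamp.nonneg _))]
  exact add_le_add (smoothRamp.monotone (by linarith)) (smoothRamp.monotone (by linarith))

theorem eq_zero {x : ℝ} (hx : 3 ≤ x) : smoothGain x = 0 := by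
  have h := smoothRamp.nonneg 1
  rw [smoothGain, smoothRamp.of_nonpos (by linarith), smoothRamp.of_nonpos (by linarith), add_zero]

theorem half : smoothGain (1 / 2) = 4 := by
  have h := smoothRamp.one_le_one
  rw [smoothGain, smoothRamp.of_one_le (by linarith),
    smoothRamp.of_one_le (t := 3 - smoothRamp 1 - 1 / 2) (by linarith)]
  ring

theorem deriv_half : deriv smoothGain (1 / 2) = -8 := by
  have h := smoothRamp.one_le_one
  rw [(hasDerivAt _).deriv, smoothTransition.one_of_one_le (by linarith),
    smoothTransition.one_of_one_le (by linarith)]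
  norm_num

theorem one : smoothGain 1 = 1 := by
  have h := smoothRamp.one_le_one
  have h' := smoothRamp.nonneg 1
  rw [smoothGain, smoothRamp.of_nonpos (by linarith),
    smoothRamp.of_one_le (t := 3 - smoothRamp 1 - 1) (by linarith)]
  ring

theorem deriv_one : deriv smoothGain 1 = -1 := by
  have h := smoothRamp.one_le_one
  have h' := smoothRamp.nonneg 1
  rw [(hasDerivAt _).deriv, smoothTransition.zero_of_nonpos (by linarith),
    smoothTransition.one_of_one_le (by linarith)]
  norm_num

end smoothGain

end

/-- Example A.4: there is a bounded, convex, smooth gain function g on (0, ∞) with the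
prescribed values and slopes at 1/2 and 1 and vanishing on [3, ∞); moreover, for any
differentiable g with those values and slopes, both (c2, x0) = (1, 1) and
(c2, x0) = (2, 1/2) solve the smooth-fit system g(x0) = c2·x0⁻¹, g'(x0) = −c2·x0⁻². -/
theorem stmt_19 :
    (∃ g : ℝ → ℝ,
      (∃ C : ℝ, ∀ x : ℝ, 0 < x → |g x| ≤ C) ∧
      ConvexOn ℝ (Ioi 0) g ∧
      ContDiffOn ℝ (⊤ : ℕ∞) g (Ioi 0) ∧
      g (1/2) = 4 ∧ deriv g (1/2) = -8 ∧ g 1 = 1 ∧ deriv g 1 = -1 ∧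
      (∀ x : ℝ, 3 ≤ x → g x = 0)) ∧
    (∀ g : ℝ → ℝ, (∀ x : ℝ, 0 < x → DifferentiableAt ℝ g x) →
      g (1/2) = 4 → deriv g (1/2) = -8 → g 1 = 1 → deriv g 1 = -1 →
      (g 1 = 1 * (1 : ℝ)⁻¹ ∧ deriv g 1 = -(1 * ((1 : ℝ)^2)⁻¹)) ∧
      (g (1/2) = 2 * ((1/2 : ℝ))⁻¹ ∧ deriv g (1/2) = -(2 * (((1/2 : ℝ))^2)⁻¹))) := by
  refine ⟨⟨smoothGain, ⟨smoothGain 0, fun _ => smoothGain.abs_le⟩,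
    smoothGain.convexOn.subset (subset_univ _) (convex_Ioi 0), smoothGain.contDiff.contDiffOn,
    smoothGain.half, smoothGain.deriv_half, smoothGain.one, smoothGain.deriv_one,
    fun _ => smoothGain.eq_zero⟩, ?_⟩
  intro g _ h₁ h₂ h₃ h₄
  rw [h₁, h₂, h₃, h₄]
  norm_num
end
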